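/- Assume the solution is nontrivial (S is not a horizontal line) and u² + v² ≠ 0 at every point of the closure of Ω. Then for every point (x, y) in the closure of Ω, g·minη ≤ P(x, y) − Patm + g y ≤ g·maxη; moreover, equality in the upper bound holds only at crests and equality in the lower bound holds only at troughs. -/

import Mathlib

open Set

/-- Partial derivative in the horizontal direction. -/
noncomputable def pdX (f : ℝ × ℝ → ℝ) (p : ℝ × ℝ) : ℝ := fderiv ℝ f p (1, 0)

/-- Partial derivative in the vertical direction. -/
noncomputable def pdY (f : ℝ × ℝ → ℝ) (p : ℝ × ℝ) : ℝ := fderiv ℝ f p (0, 1)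

/-- A general (possibly overturning, possibly asymmetric) horizontally `2L`-periodic
steady water wave.  The free surface `S` is the non-self-intersecting `C²` curve
parametrized by `s ↦ (X s, Y s)`, lying above the bed `B = {y = -d}`, and the fluid
domain `Ω` is the open connected `2L`-periodic region whose boundary is `S ∪ B`.
The flow `(u, v)` with pressure `P` solves the steady Euler equations in `Ω`, is
tangent to `S`, has `P = Patm` on `S` and `v = 0` on `B`; `ψ` is a stream function,
vanishing on `S` and equal to the constant `m` on `B`. -/
structure GenPeriodicFlow (g Patm L d : ℝ) : Type where
  X : ℝ → ℝ
  Y : ℝ → ℝ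
  T : ℝ
  u : ℝ × ℝ → ℝ
  v : ℝ × ℝ → ℝ
  P : ℝ × ℝ → ℝ
  ψ : ℝ × ℝ → ℝ
  m : ℝ
  Ω : Set (ℝ × ℝ)
  T_pos : 0 < T
  X_smooth : ContDiff ℝ 2 X
  Y_smooth : ContDiff ℝ 2 Y
  regular : ∀ s, deriv X s ^ 2 + deriv Y s ^ 2 ≠ 0
  X_per : ∀ s, X (s + T) = X s + 2 * L
  Y_per : ∀ s, Y (s + T) = Y s
  S_above_bed : ∀ s, -d < Y s
  S_simple : ∀ s s', X s = X s' → Y s = Y s' → ∃ n : ℤ, s' = s + n * T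
  Ω_open : IsOpen Ω
  Ω_conn : IsConnected Ω
  Ω_per : ∀ p : ℝ × ℝ, p ∈ Ω ↔ (p.1 + 2 * L, p.2) ∈ Ω
  Ω_frontier : frontier Ω = (range fun s => (X s, Y s)) ∪ {p : ℝ × ℝ | p.2 = -d}
  u_smooth : ContDiff ℝ 1 u
  v_smooth : ContDiff ℝ 1 v
  P_smooth : ContDiff ℝ 2 P
  ψ_smooth : ContDiff ℝ 2 ψ
  u_periodic : ∀ x y, u (x + 2 * L, y) = u (x, y)
  v_periodic : ∀ x y, v (x + 2 * L, y) = v (x, y)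
  P_periodic : ∀ x y, P (x + 2 * L, y) = P (x, y)
  euler_x : ∀ p ∈ Ω, u p * pdX u p + v p * pdY u p = -pdX P p
  euler_y : ∀ p ∈ Ω, u p * pdX v p + v p * pdY v p = -(pdY P p) - g
  incompressible : ∀ p ∈ Ω, pdX u p + pdY v p = 0
  surface_pressure : ∀ s, P (X s, Y s) = Patm
  surface_tangency : ∀ s, u (X s, Y s) * deriv Y s = v (X s, Y s) * deriv X s
  bed_kinematic : ∀ x, v (x, -d) = 0
  psi_x : ∀ p ∈ closure Ω, pdX ψ p = -v p
  psi_y : ∀ p ∈ closure Ω, pdY ψ p = u p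
  psi_surface : ∀ s, ψ (X s, Y s) = 0
  psi_bed : ∀ x, ψ (x, -d) = m

namespace GenPeriodicFlow

variable {g Patm L d : ℝ}

/-- The vorticity `ω = v_x - u_y`. -/
noncomputable def vort (F : GenPeriodicFlow g Patm L d) (p : ℝ × ℝ) : ℝ :=
  pdX F.v p - pdY F.u p

/-- The free surface `S`, as a subset of the plane. -/
def surf (F : GenPeriodicFlow g Patm L d) : Set (ℝ × ℝ) :=
  range fun s => (F.X s, F.Y s)

/-- The maximal surface height `maxη = max_S y`. -/
noncomputable def maxη (F : GenPeriodicFlow g Patm L d) : ℝ := sSup (range F.Y)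

/-- The minimal surface height `minη = min_S y`. -/
noncomputable def minη (F : GenPeriodicFlow g Patm L d) : ℝ := sInf (range F.Y)

/-- The solution is nontrivial: `S` is not a horizontal line. -/
def Nontrivial' (F : GenPeriodicFlow g Patm L d) : Prop := ∃ s s', F.Y s ≠ F.Y s'

/-- `n` is an outward (non-fluid side) normal to `S` at the parameter `s`:
it is orthogonal to the tangent vector and points out of the fluid. -/
def IsOutwardNormalAt (F : GenPeriodicFlow g Patm L d) (n : ℝ × ℝ) (s : ℝ) : Prop :=
  n.1 * deriv F.X s + n.2 * deriv F.Y s = 0 ∧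
  ∃ t₀ > 0, ∀ t, 0 < t → t < t₀ → (F.X s + t * n.1, F.Y s + t * n.2) ∉ closure F.Ω

end GenPeriodicFlow

/-- A closed curve in the disc `‖z - 1‖ < 1` does not wind around the origin. -/
theorem integral_deriv_div_eq_zero {h h' : ℝ → ℂ} {a b : ℝ} (hab : a ≤ b)
    (hd : ∀ s, HasDerivAt h (h' s) s) (hc : Continuous h')
    (h1 : ∀ s ∈ Icc a b, ‖h s - 1‖ < 1) (hclosed : h a = h b) :
    ∫ s in a..b, h' s / h s = 0 := by
  have hslit : ∀ s ∈ Icc a b, h s ∈ Complex.slitPlane := fun s hs => by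
    simpa using Complex.mem_slitPlane_of_norm_lt_one (h1 s hs)
  have hcont : Continuous h := continuous_iff_continuousAt.2 fun s => (hd s).continuousAt
  rw [intervalIntegral.integral_eq_sub_of_hasDerivAt (f := fun s => Complex.log (h s))]
  · simp [hclosed]
  · intro s hs
    rw [uIcc_of_le hab] at hs
    exact (hd s).clog_real (hslit s hs)
  · apply ContinuousOn.intervalIntegrable
    rw [uIcc_of_le hab]
    exact hc.continuousOn.div hcont.continuousOn
      fun s hs => Complex.slitPlane_ne_zero (hslit s hs)

/-- The winding integral of a closed curve is unchanged under small moves of the base point. -/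
theorem integral_div_sub_eq {ζ ζ' : ℝ → ℂ} {a b : ℝ} (hab : a ≤ b)
    (hd : ∀ s, HasDerivAt ζ (ζ' s) s) (hc : Continuous ζ') (hclosed : ζ a = ζ b) {w w' : ℂ}
    (hw : ∀ s ∈ Icc a b, ‖w' - w‖ < ‖ζ s - w‖) :
    ∫ s in a..b, ζ' s / (ζ s - w') = ∫ s in a..b, ζ' s / (ζ s - w) := by
  have hcont : Continuous ζ := continuous_iff_continuousAt.2 fun s => (hd s).continuousAt
  have hne : ∀ s ∈ Icc a b, ζ s - w ≠ 0 := fun s hs =>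
    norm_pos_iff.1 ((norm_nonneg _).trans_lt (hw s hs))
  have hne' : ∀ s ∈ Icc a b, ζ s - w' ≠ 0 := fun s hs h0 => by
    have := hw s hs
    rw [sub_eq_zero.1 h0] at this
    exact lt_irrefl _ this
  have hF : ∀ z : ℂ, (∀ s ∈ Icc a b, ζ s - z ≠ 0) →
      IntervalIntegrable (fun s => ζ' s / (ζ s - z)) MeasureTheory.volume a b := by
    intro z hz
    apply ContinuousOn.intervalIntegrable
    rw [uIcc_of_le hab]
    exact hc.continuousOn.div (hcont.sub continuous_const).continuousOn hz
  rw [← sub_eq_zero, ← intervalIntegral.integral_sub (hF _ hne') (hF _ hne)]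
  rw [intervalIntegral.integral_eq_sub_of_hasDerivAt
    (f := fun s => Complex.log ((ζ s - w') / (ζ s - w)))]
  · simp [hclosed]
  · intro s hs
    rw [uIcc_of_le hab] at hs
    have h0 := hne s hs
    have h0' := hne' s hs
    have hsl : (ζ s - w') / (ζ s - w) ∈ Complex.slitPlane := by
      have : ‖(w - w') / (ζ s - w)‖ < 1 := by
        rw [norm_div, div_lt_one (norm_pos_iff.2 h0), norm_sub_rev]
        exact hw s hs
      have h2 := Complex.mem_slitPlane_of_norm_lt_one this
      convert h2 using 1
      field_simp
      ring
    have hquot : HasDerivAt (fun s => (ζ s - w') / (ζ s - w)) _ s :=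
      ((hd s).sub_const w').div ((hd s).sub_const w) h0
    refine (hquot.clog_real hsl).congr_deriv ?_
    field_simp
  · exact (hF _ hne').sub (hF _ hne)

/-- The winding integral vanishes around a base point far from the curve. -/
theorem integral_div_sub_eq_zero {ζ ζ' : ℝ → ℂ} {a b : ℝ} (hab : a ≤ b)
    (hd : ∀ s, HasDerivAt ζ (ζ' s) s) (hc : Continuous ζ') (hclosed : ζ a = ζ b) {w : ℂ}
    (hw : ∀ s ∈ Icc a b, ‖ζ s‖ < ‖w‖) :
    ∫ s in a..b, ζ' s / (ζ s - w) = 0 := by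
  have hw0 : w ≠ 0 := norm_pos_iff.1 ((norm_nonneg _).trans_lt (hw a ⟨le_rfl, hab⟩))
  rw [← integral_deriv_div_eq_zero (h := fun s => 1 - ζ s / w) (h' := fun s => -(ζ' s / w)) hab
    (fun s => ((hd s).div_const w).const_sub 1) (hc.div_const w).neg
    (fun s hs => by simpa [norm_div, div_lt_one (norm_pos_iff.2 hw0)] using hw s hs)
    (by simp only [hclosed])]
  apply intervalIntegral.integral_congr
  intro s hs
  rw [uIcc_of_le hab] at hs
  have : ζ s - w ≠ 0 := fun h0 => (hw s hs).ne (by rw [sub_eq_zero.1 h0])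
  have : w - ζ s ≠ 0 := fun h0 => this (by rw [← neg_sub, h0, neg_zero])
  simp only
  have h3 : 1 - ζ s / w ≠ 0 := by
    rw [one_sub_div hw0]; exact div_ne_zero this hw0
  field_simp
  ring

/-- A continuous closed curve avoiding the connected open set `U` has constant winding integral
over the image of `U` under a continuous map. -/
theorem integral_div_sub_eq_of_isPreconnected {ζ ζ' : ℝ → ℂ} {a b : ℝ} (hab : a ≤ b)
    (hd : ∀ s, HasDerivAt ζ (ζ' s) s) (hc : Continuous ζ') (hclosed : ζ a = ζ b)
    {U : Set (ℝ × ℝ)} (hUo : IsOpen U) (hU : IsPreconnected U) {e : ℝ × ℝ → ℂ} (he : Continuous e)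
    (hne : ∀ p ∈ U, ∀ s ∈ Icc a b, ζ s ≠ e p) {p q : ℝ × ℝ} (hp : p ∈ U) (hq : q ∈ U) :
    ∫ s in a..b, ζ' s / (ζ s - e p) = ∫ s in a..b, ζ' s / (ζ s - e q) := by
  have hcont : Continuous ζ := continuous_iff_continuousAt.2 fun s => (hd s).continuousAt
  have hloc : ∀ p ∈ U, (fun p => ∫ s in a..b, ζ' s / (ζ s - e p)) =ᶠ[nhds p]
      fun _ => ∫ s in a..b, ζ' s / (ζ s - e p) := by
    intro p hp
    obtain ⟨s₀, hs₀, hmin⟩ := isCompact_Icc.exists_isMinOn (nonempty_Icc.2 hab)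
      (show Continuous fun s => ‖ζ s - e p‖ by fun_prop).continuousOn
    have hpos : 0 < ‖ζ s₀ - e p‖ := norm_pos_iff.2 (sub_ne_zero.2 (hne p hp s₀ hs₀))
    have hec : Continuous fun q => ‖e q - e p‖ := by fun_prop
    have : ∀ᶠ q in nhds p, ‖e q - e p‖ < ‖ζ s₀ - e p‖ :=
      hec.continuousAt.eventually_lt continuousAt_const
        (by simpa only [sub_self, norm_zero] using hpos)
    filter_upwards [this] with q hq
    exact integral_div_sub_eq hab hd hc hclosed fun s hs => hq.trans_le (hmin hs)
  obtain ⟨c, hc⟩ := hUo.exists_is_const_of_fderiv_eq_zero (𝕜 := ℝ) hU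
    (f := fun p => ∫ s in a..b, ζ' s / (ζ s - e p))
    (fun p hp => ((hasFDerivAt_const _ p).congr_of_eventuallyEq
      (hloc p hp)).differentiableAt.differentiableWithinAt)
    (fun p hp => ((hasFDerivAt_const _ p).congr_of_eventuallyEq (hloc p hp)).fderiv)
  exact (hc p hp).trans (hc q hq).symm

/-- Second-derivative test: the second derivative at a local maximum is nonpositive. -/
theorem IsLocalMax.second_deriv_nonpos {f f' : ℝ → ℝ} {x c : ℝ} (hmax : IsLocalMax f x)
    (hf : ∀ t, HasDerivAt f (f' t) t) (hf' : HasDerivAt f' c x) : c ≤ 0 := by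
  by_contra! hc
  have hd : deriv f = f' := funext fun t => (hf t).deriv
  have hmin : IsLocalMin f x := by
    apply isLocalMin_of_deriv_deriv_pos
    · rw [hd, hf'.deriv]; exact hc
    · exact hmax.deriv_eq_zero
    · exact (hf x).continuousAt
  have heq : f =ᶠ[nhds x] fun _ => f x := by
    filter_upwards [hmax, hmin] with t h1 h2 using le_antisymm h1 h2
  have : deriv f =ᶠ[nhds x] fun _ => 0 := by
    have := heq.deriv
    simpa using this
  rw [hd] at this
  have h0 := this.deriv_eq
  rw [hf'.deriv] at h0
  simp at h0
  exact hc.ne' h0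

theorem hasDerivAt_pdX {f : ℝ × ℝ → ℝ} (hf : Differentiable ℝ f) (x y : ℝ) :
    HasDerivAt (fun t => f (t, y)) (pdX f (x, y)) x :=
  (hf (x, y)).hasFDerivAt.comp_hasDerivAt x ((hasDerivAt_id x).prodMk (hasDerivAt_const x y))

theorem hasDerivAt_pdY {f : ℝ × ℝ → ℝ} (hf : Differentiable ℝ f) (x y : ℝ) :
    HasDerivAt (fun t => f (x, t)) (pdY f (x, y)) y :=
  (hf (x, y)).hasFDerivAt.comp_hasDerivAt y ((hasDerivAt_const y x).prodMk (hasDerivAt_id y))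

theorem ContDiff.pdX {f : ℝ × ℝ → ℝ} {m n : WithTop ℕ∞} (hf : ContDiff ℝ n f) (h : m + 1 ≤ n) :
    ContDiff ℝ m (pdX f) :=
  (hf.fderiv_right h).clm_apply contDiff_const

theorem ContDiff.pdY {f : ℝ × ℝ → ℝ} {m n : WithTop ℕ∞} (hf : ContDiff ℝ n f) (h : m + 1 ≤ n) :
    ContDiff ℝ m (pdY f) :=
  (hf.fderiv_right h).clm_apply contDiff_const

theorem fderiv_apply_eq_pd (f : ℝ × ℝ → ℝ) (p q : ℝ × ℝ) :
    fderiv ℝ f p q = q.1 * pdX f p + q.2 * pdY f p := by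
  have : q = q.1 • ((1, 0) : ℝ × ℝ) + q.2 • ((0, 1) : ℝ × ℝ) := by ext <;> simp
  conv_lhs => rw [this]
  rw [map_add, map_smul, map_smul, smul_eq_mul, smul_eq_mul, pdX, pdY]

/-- The radial barrier `exp (-α r²) - exp (-α R²)` with large `α` rules out local maxima of
`Q + ε h` in the open annulus `R / 2 < r < R`. -/
theorem not_isLocalMax_add_barrier {Q : ℝ × ℝ → ℝ} (hQ : ContDiff ℝ 2 Q)
    {a b R K α ε β₁ β₂ : ℝ} (hR : 0 < R) (hK : 0 ≤ K) (hα0 : 0 < α)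
    (hα : 4 + 4 * K * R < α * R ^ 2) (hε : 0 < ε) {z : ℝ × ℝ}
    (h1 : R ^ 2 / 4 < (z.1 - a) ^ 2 + (z.2 - b) ^ 2) (h2 : (z.1 - a) ^ 2 + (z.2 - b) ^ 2 < R ^ 2)
    (hpde : pdX (pdX Q) z + pdY (pdY Q) z = β₁ * pdX Q z + β₂ * pdY Q z)
    (hb1 : |β₁| ≤ K) (hb2 : |β₂| ≤ K) :
    ¬ IsLocalMax (fun z : ℝ × ℝ => Q z + ε * (Real.exp (-α * ((z.1 - a) ^ 2 + (z.2 - b) ^ 2))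
      - Real.exp (-α * R ^ 2))) z := by
  intro hloc
  have hQd : Differentiable ℝ Q := hQ.differentiable (by norm_num)
  have hQx : Differentiable ℝ (pdX Q) :=
    (hQ.pdX (m := 1) (by norm_num)).differentiable (by norm_num)
  have hQy : Differentiable ℝ (pdY Q) :=
    (hQ.pdY (m := 1) (by norm_num)).differentiable (by norm_num)
  set N : ℝ × ℝ → ℝ := fun z => (z.1 - a) ^ 2 + (z.2 - b) ^ 2 with hN
  obtain ⟨x, y⟩ := z
  have hxc : IsLocalMax (fun t => Q (t, y) + ε * (Real.exp (-α * N (t, y)) - Real.exp (-α * R ^ 2))) x :=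
    hloc.comp_continuous (g := fun t : ℝ => (t, y)) (by fun_prop)
  have hyc : IsLocalMax (fun t => Q (x, t) + ε * (Real.exp (-α * N (x, t)) - Real.exp (-α * R ^ 2))) y :=
    hloc.comp_continuous (g := fun t : ℝ => (x, t)) (by fun_prop)
  have dx : ∀ t, HasDerivAt (fun t => Q (t, y) + ε * (Real.exp (-α * N (t, y)) - Real.exp (-α * R ^ 2)))
      (pdX Q (t, y) + ε * (Real.exp (-α * N (t, y)) * (-α * (2 * (t - a))))) t := by
    intro t
    have e1 : HasDerivAt (fun t => -α * N (t, y)) (-α * (2 * (t - a))) t := by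
      have := ((((hasDerivAt_id t).sub_const a).pow 2).add_const ((y - b) ^ 2)).const_mul (-α)
      simpa [hN] using this
    exact (hasDerivAt_pdX hQd t y).add ((e1.exp.sub_const _).const_mul ε)
  have dy : ∀ t, HasDerivAt (fun t => Q (x, t) + ε * (Real.exp (-α * N (x, t)) - Real.exp (-α * R ^ 2)))
      (pdY Q (x, t) + ε * (Real.exp (-α * N (x, t)) * (-α * (2 * (t - b))))) t := by
    intro t
    have e1 : HasDerivAt (fun t => -α * N (x, t)) (-α * (2 * (t - b))) t := by
      have := ((((hasDerivAt_id t).sub_const b).pow 2).const_add ((x - a) ^ 2)).const_mul (-α)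
      simpa [hN] using this
    exact (hasDerivAt_pdY hQd x t).add ((e1.exp.sub_const _).const_mul ε)
  set E := Real.exp (-α * N (x, y)) with hE
  have hEpos : 0 < E := Real.exp_pos _
  have ddx : HasDerivAt (fun t => pdX Q (t, y) + ε * (Real.exp (-α * N (t, y)) * (-α * (2 * (t - a)))))
      (pdX (pdX Q) (x, y) + ε * (E * (-α * (2 * (x - a))) * (-α * (2 * (x - a))) + E * (-α * 2))) x := by
    have e1 : HasDerivAt (fun t => -α * N (t, y)) (-α * (2 * (x - a))) x := by
      have := ((((hasDerivAt_id x).sub_const a).pow 2).add_const ((y - b) ^ 2)).const_mul (-α)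
      simpa [hN] using this
    have e2 : HasDerivAt (fun t : ℝ => -α * (2 * (t - a))) (-α * 2) x := by
      simpa using (((hasDerivAt_id x).sub_const a).const_mul 2).const_mul (-α)
    exact (hasDerivAt_pdX hQx x y).add ((e1.exp.mul e2).const_mul ε)
  have ddy : HasDerivAt (fun t => pdY Q (x, t) + ε * (Real.exp (-α * N (x, t)) * (-α * (2 * (t - b)))))
      (pdY (pdY Q) (x, y) + ε * (E * (-α * (2 * (y - b))) * (-α * (2 * (y - b))) + E * (-α * 2))) y := by
    have e1 : HasDerivAt (fun t => -α * N (x, t)) (-α * (2 * (y - b))) y := by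
      have := ((((hasDerivAt_id y).sub_const b).pow 2).const_add ((x - a) ^ 2)).const_mul (-α)
      simpa [hN] using this
    have e2 : HasDerivAt (fun t : ℝ => -α * (2 * (t - b))) (-α * 2) y := by
      simpa using (((hasDerivAt_id y).sub_const b).const_mul 2).const_mul (-α)
    exact (hasDerivAt_pdY hQy x y).add ((e1.exp.mul e2).const_mul ε)
  have gx := hxc.hasDerivAt_eq_zero (dx x)
  have gy := hyc.hasDerivAt_eq_zero (dy y)
  have sx := hxc.second_deriv_nonpos dx ddx
  have sy := hyc.second_deriv_nonpos dy ddy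
  have hN1 : R ^ 2 / 4 < (x - a) ^ 2 + (y - b) ^ 2 := h1
  have hN2 : (x - a) ^ 2 + (y - b) ^ 2 < R ^ 2 := h2
  have hxa : |x - a| ≤ R := abs_le_of_sq_le_sq (by nlinarith [sq_nonneg (y - b)]) hR.le
  have hyb : |y - b| ≤ R := abs_le_of_sq_le_sq (by nlinarith [sq_nonneg (x - a)]) hR.le
  have m1 : |β₁ * (x - a)| ≤ K * R := by
    rw [abs_mul]; exact mul_le_mul hb1 hxa (abs_nonneg _) hK
  have m2 : |β₂ * (y - b)| ≤ K * R := by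
    rw [abs_mul]; exact mul_le_mul hb2 hyb (abs_nonneg _) hK
  have m1' := (abs_le.1 m1).1
  have m2' := (abs_le.1 m2).1
  rw [← hE] at gx gy
  have hsum : ε * E * α * (2 * (β₁ * (x - a) + β₂ * (y - b))
      + 4 * (α * ((x - a) ^ 2 + (y - b) ^ 2)) - 4) ≤ 0 := by
    have gx' : pdX Q (x, y) = ε * (E * (α * (2 * (x - a)))) := by linarith
    have gy' : pdY Q (x, y) = ε * (E * (α * (2 * (y - b)))) := by linarith
    rw [gx', gy'] at hpde
    linear_combination sx + sy - hpde
  have hpos : 0 < 2 * (β₁ * (x - a) + β₂ * (y - b))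
      + 4 * (α * ((x - a) ^ 2 + (y - b) ^ 2)) - 4 := by
    have : α * (R ^ 2 / 4) < α * ((x - a) ^ 2 + (y - b) ^ 2) := mul_lt_mul_of_pos_left hN1 hα0
    linarith
  have : 0 < ε * E * α := by positivity
  exact absurd hsum (not_le.2 (mul_pos this hpos))

theorem isCompact_disc (a b : ℝ) {R : ℝ} (hR : 0 ≤ R) :
    IsCompact {z : ℝ × ℝ | (z.1 - a) ^ 2 + (z.2 - b) ^ 2 ≤ R ^ 2} := by
  apply (isCompact_Icc (a := a - R) (b := a + R)).prod
    (isCompact_Icc (a := b - R) (b := b + R)) |>.of_isClosed_subset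
  · exact isClosed_le (by fun_prop) continuous_const
  · intro z hz
    rw [mem_ofPred_eq] at hz
    have h1 : |z.1 - a| ≤ R := abs_le_of_sq_le_sq (by nlinarith [sq_nonneg (z.2 - b)]) hR
    have h2 : |z.2 - b| ≤ R := abs_le_of_sq_le_sq (by nlinarith [sq_nonneg (z.1 - a)]) hR
    rw [abs_le] at h1 h2
    refine ⟨⟨?_, ?_⟩, ⟨?_, ?_⟩⟩ <;> linarith

/-- Hopf boundary point lemma on a disc for the operator `Δ - β·∇` with bounded drift `β`. -/
theorem hopf_disc {Q β₁ β₂ : ℝ × ℝ → ℝ} (hQ : ContDiff ℝ 2 Q) {a b R K M : ℝ} (hR : 0 < R)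
    (hβ₁ : ∀ z : ℝ × ℝ, (z.1 - a) ^ 2 + (z.2 - b) ^ 2 < R ^ 2 → |β₁ z| ≤ K)
    (hβ₂ : ∀ z : ℝ × ℝ, (z.1 - a) ^ 2 + (z.2 - b) ^ 2 < R ^ 2 → |β₂ z| ≤ K)
    (heq : ∀ z : ℝ × ℝ, (z.1 - a) ^ 2 + (z.2 - b) ^ 2 < R ^ 2 →
      pdX (pdX Q) z + pdY (pdY Q) z = β₁ z * pdX Q z + β₂ z * pdY Q z)
    (hlt : ∀ z : ℝ × ℝ, (z.1 - a) ^ 2 + (z.2 - b) ^ 2 < R ^ 2 → Q z < M)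
    (hle : ∀ z : ℝ × ℝ, (z.1 - a) ^ 2 + (z.2 - b) ^ 2 ≤ R ^ 2 → Q z ≤ M)
    {p : ℝ × ℝ} (hp : (p.1 - a) ^ 2 + (p.2 - b) ^ 2 = R ^ 2) (hpM : Q p = M) :
    0 < (p.1 - a) * pdX Q p + (p.2 - b) * pdY Q p := by
  have hK : 0 ≤ K := (abs_nonneg _).trans (hβ₁ (a, b) (by simpa using by positivity))
  have hQd : Differentiable ℝ Q := hQ.differentiable (by norm_num)
  set N : ℝ × ℝ → ℝ := fun z => (z.1 - a) ^ 2 + (z.2 - b) ^ 2 with hN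
  have hNc : Continuous N := by fun_prop
  obtain ⟨α, hα0, hα⟩ : ∃ α : ℝ, 0 < α ∧ 4 + 4 * K * R < α * R ^ 2 := by
    refine ⟨(5 + 4 * K * R) / R ^ 2, by positivity, ?_⟩
    rw [div_mul_cancel₀ _ (by positivity)]
    linarith
  have hcpt : ∀ c : ℝ, IsCompact {z | c ≤ N z ∧ N z ≤ R ^ 2} := fun c =>
    (isCompact_disc a b hR.le).inter_left (isClosed_le continuous_const hNc)
  -- gap on the inner disc
  obtain ⟨ε, hε, hgap⟩ : ∃ ε > 0, ∀ z, N z = R ^ 2 / 4 → Q z ≤ M - ε := by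
    have hin : IsCompact {z | N z = R ^ 2 / 4} := by
      apply (hcpt (R ^ 2 / 4)).of_isClosed_subset (isClosed_eq hNc continuous_const)
      intro z hz
      have hz' : N z = R ^ 2 / 4 := hz
      constructor <;> nlinarith
    have hne : {z | N z = R ^ 2 / 4}.Nonempty := ⟨(a + R / 2, b), by simp [hN]; ring⟩
    obtain ⟨z₀, hz₀, hmax⟩ := hin.exists_isMaxOn hne hQ.continuous.continuousOn
    have h0 : N z₀ = R ^ 2 / 4 := hz₀
    have : Q z₀ < M := hlt z₀ (by change N z₀ < _; rw [h0]; nlinarith)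
    exact ⟨M - Q z₀, by linarith, fun z hz => by have := hmax hz; simp only [mem_ofPred_eq] at this; linarith⟩
  set h : ℝ × ℝ → ℝ := fun z => Real.exp (-α * N z) - Real.exp (-α * R ^ 2) with hh
  have hhc : Continuous h := by fun_prop
  have key : ∀ z, R ^ 2 / 4 ≤ N z → N z ≤ R ^ 2 → Q z + ε * h z ≤ M := by
    obtain ⟨z, ⟨hz1, hz2⟩, hmax⟩ := (hcpt (R ^ 2 / 4)).exists_isMaxOn
      ⟨p, by constructor <;> simp only [hN] <;> nlinarith⟩
      ((hQ.continuous.add (continuous_const.mul hhc) : Continuous fun z => Q z + ε * h z).continuousOn)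
    suffices Q z + ε * h z ≤ M from fun q h1 h2 => (hmax (⟨h1, h2⟩ : q ∈ {z | _ ∧ _})).trans this
    rcases hz2.eq_or_lt with h2 | h2
    · have : h z = 0 := by simp [hh, h2]
      rw [this]; simpa using hle z hz2
    rcases hz1.eq_or_lt with h1 | h1
    · have hb : h z ≤ 1 := by
        have e1 : Real.exp (-α * N z) ≤ 1 := Real.exp_le_one_iff.2 (by rw [← h1]; nlinarith [mul_pos hα0 (pow_pos hR 2)])
        have e2 := Real.exp_pos (-α * R ^ 2)
        simp only [hh]; linarith
      have := hgap z h1.symm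
      nlinarith
    exfalso
    have hloc : IsLocalMax (fun z => Q z + ε * h z) z := by
      apply hmax.isLocalMax
      filter_upwards [(isOpen_lt continuous_const hNc).mem_nhds h1,
        (isOpen_lt hNc continuous_const).mem_nhds h2] with q q1 q2
      exact ⟨le_of_lt q1, le_of_lt q2⟩
    exact not_isLocalMax_add_barrier hQ hR hK hα0 hα hε h1 h2 (heq z h2) (hβ₁ z h2) (hβ₂ z h2) hloc
  -- compare along the radius through `p`
  set c : ℝ × ℝ := (a, b)
  have hφ : HasDerivAt (fun t : ℝ => Q (p + t • (c - p)) + ε * (Real.exp (-α * ((1 - t) ^ 2 * R ^ 2)) - Real.exp (-α * R ^ 2)))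
      (fderiv ℝ Q p (c - p) + ε * (Real.exp (-α * R ^ 2) * (-α * (-2 * R ^ 2)))) 0 := by
    have l1 : HasDerivAt (fun t : ℝ => p + t • (c - p)) (c - p) 0 := by
      simpa using ((hasDerivAt_id (0 : ℝ)).smul_const (c - p)).const_add p
    have l2 : HasDerivAt (fun t : ℝ => Q (p + t • (c - p))) (fderiv ℝ Q p (c - p)) 0 := by
      have hq : HasFDerivAt Q (fderiv ℝ Q p) (p + (0 : ℝ) • (c - p)) := by
        simpa using (hQd p).hasFDerivAt
      exact hq.comp_hasDerivAt 0 l1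
    have l3 : HasDerivAt (fun t : ℝ => -α * ((1 - t) ^ 2 * R ^ 2)) (-α * (-2 * R ^ 2)) 0 := by
      have := ((((hasDerivAt_id (0 : ℝ)).const_sub 1).pow 2).mul_const (R ^ 2)).const_mul (-α)
      simpa using this
    have l4 := l3.exp
    have : (-α * ((1 - (0 : ℝ)) ^ 2 * R ^ 2)) = -α * R ^ 2 := by ring
    rw [this] at l4
    exact l2.add ((l4.sub_const _).const_mul ε)
  have hφle : ∀ t ∈ Icc (0 : ℝ) (1 / 2), Q (p + t • (c - p)) + ε * (Real.exp (-α * ((1 - t) ^ 2 * R ^ 2)) - Real.exp (-α * R ^ 2)) ≤ M := by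
    rintro t ⟨ht0, ht1⟩
    have hNt : N (p + t • (c - p)) = (1 - t) ^ 2 * R ^ 2 := by
      rw [← hp]; simp [hN, c]; ring
    have hlow : 1 / 4 ≤ (1 - t) ^ 2 := by nlinarith
    have hup : (1 - t) ^ 2 ≤ 1 := by nlinarith
    have := key (p + t • (c - p)) 
      (by rw [hNt]; nlinarith [mul_le_mul_of_nonneg_right hlow (sq_nonneg R)])
      (by rw [hNt]; nlinarith [mul_le_mul_of_nonneg_right hup (sq_nonneg R)])
    simpa only [hh, hNt] using this
  have hnonpos : fderiv ℝ Q p (c - p) + ε * (Real.exp (-α * R ^ 2) * (-α * (-2 * R ^ 2))) ≤ 0 := by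
    have ht := (hasDerivWithinAt_iff_tendsto_slope' (by simp)).1 (hφ.hasDerivWithinAt (s := Ioi 0))
    refine le_of_tendsto ht ?_
    filter_upwards [Ioo_mem_nhdsGT (show (0 : ℝ) < 1 / 2 by norm_num)] with t ht
    rw [slope_def_field]
    apply div_nonpos_of_nonpos_of_nonneg _ (by linarith [ht.1])
    have := hφle t ⟨ht.1.le, ht.2.le⟩
    simp only [zero_smul, add_zero, sub_zero, one_pow, one_mul, sub_self, mul_zero, hpM]
    linarith
  rw [fderiv_apply_eq_pd] at hnonpos
  have : 0 < ε * (Real.exp (-α * R ^ 2) * (-α * (-2 * R ^ 2))) := by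
    have : -α * (-2 * R ^ 2) = 2 * α * R ^ 2 := by ring
    rw [this]; positivity
  simp only [c, Prod.fst_sub, Prod.snd_sub] at hnonpos
  linarith

/-- Strong maximum principle for `Δ - β·∇` with continuous drift `β` on a planar domain. -/
theorem eq_max_of_isPreconnected {Q β₁ β₂ : ℝ × ℝ → ℝ} (hQ : ContDiff ℝ 2 Q) {Ω : Set (ℝ × ℝ)}
    (hΩ : IsOpen Ω) (hΩc : IsPreconnected Ω) (hβ₁ : ContinuousOn β₁ Ω) (hβ₂ : ContinuousOn β₂ Ω)
    (heq : ∀ z ∈ Ω, pdX (pdX Q) z + pdY (pdY Q) z = β₁ z * pdX Q z + β₂ z * pdY Q z)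
    {M : ℝ} (hle : ∀ z ∈ Ω, Q z ≤ M) {p : ℝ × ℝ} (hp : p ∈ Ω) (hpM : Q p = M) :
    ∀ q ∈ Ω, Q q = M := by
  have hQc := hQ.continuous
  suffices hopen : IsOpen {z | z ∈ Ω ∧ Q z = M} by
    have hsub : Ω ⊆ {z | z ∈ Ω ∧ Q z = M} := by
      apply hΩc.subset_of_closure_inter_subset hopen ⟨p, hp, hp, hpM⟩
      rintro z ⟨hz, hzΩ⟩
      refine ⟨hzΩ, ?_⟩
      have : closure {z | z ∈ Ω ∧ Q z = M} ⊆ {z | Q z = M} :=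
        closure_minimal (fun z hz => hz.2) (isClosed_eq hQc continuous_const)
      exact this hz
    exact fun q hq => (hsub hq).2
  rw [isOpen_iff_mem_nhds]
  rintro p ⟨hp, hpM⟩
  obtain ⟨ε, hε, hball⟩ := Metric.isOpen_iff.1 hΩ p hp
  have hcont : Continuous fun c : ℝ × ℝ => (p.1 - c.1) ^ 2 + (p.2 - c.2) ^ 2 := by fun_prop
  have hnear : ∀ᶠ c in nhds p, (p.1 - c.1) ^ 2 + (p.2 - c.2) ^ 2 < (ε / 3) ^ 2 :=
    hcont.continuousAt.eventually_lt continuousAt_const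
      (by simpa only [sub_self, ne_eq, OfNat.ofNat_ne_zero, not_false_eq_true, zero_pow, add_zero]
        using by positivity)
  filter_upwards [hnear] with c hc
  set N : ℝ × ℝ → ℝ := fun z => (z.1 - c.1) ^ 2 + (z.2 - c.2) ^ 2 with hN
  have hNc : Continuous N := by fun_prop
  have hε3 : 0 < ε / 3 := by positivity
  have hsub : ∀ z, N z ≤ (ε / 3) ^ 2 → z ∈ Ω := by
    intro z hz
    apply hball
    simp only [hN] at hz
    have h1 := abs_le.1 (abs_le_of_sq_le_sq (a := z.1 - c.1)
      (by nlinarith [sq_nonneg (z.2 - c.2)]) hε3.le)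
    have h2 := abs_le.1 (abs_le_of_sq_le_sq (a := z.2 - c.2)
      (by nlinarith [sq_nonneg (z.1 - c.1)]) hε3.le)
    have h3 := abs_le.1 (abs_le_of_sq_le_sq (a := p.1 - c.1)
      (by nlinarith [sq_nonneg (p.2 - c.2)]) hε3.le)
    have h4 := abs_le.1 (abs_le_of_sq_le_sq (a := p.2 - c.2)
      (by nlinarith [sq_nonneg (p.1 - c.1)]) hε3.le)
    rw [Metric.mem_ball, Prod.dist_eq, Real.dist_eq, Real.dist_eq, max_lt_iff, abs_lt, abs_lt]
    refine ⟨⟨?_, ?_⟩, ⟨?_, ?_⟩⟩ <;> linarith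
  refine ⟨hsub c (by simp only [hN, sub_self]; nlinarith [sq_nonneg (ε / 3)]), ?_⟩
  by_contra hcM
  have hdisc := isCompact_disc c.1 c.2 hε3.le
  obtain ⟨z, ⟨hzN, hzM⟩, hmin⟩ :=
    (hdisc.inter_right (isClosed_eq hQc continuous_const : IsClosed {z | Q z = M})).exists_isMinOn
      ⟨p, hc.le, hpM⟩ hNc.continuousOn
  have hzN' : N z ≤ (ε / 3) ^ 2 := hzN
  have hNz : 0 < N z := by
    refine lt_of_le_of_ne (by simp only [hN]; positivity) fun h0 => hcM ?_
    have h1 : (z.1 - c.1) ^ 2 = 0 := by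
      simp only [hN] at h0; nlinarith [sq_nonneg (z.1 - c.1), sq_nonneg (z.2 - c.2)]
    have h2 : (z.2 - c.2) ^ 2 = 0 := by
      simp only [hN] at h0; nlinarith [sq_nonneg (z.1 - c.1), sq_nonneg (z.2 - c.2)]
    have : z = c := Prod.ext (sub_eq_zero.1 (pow_eq_zero_iff two_ne_zero |>.1 h1))
      (sub_eq_zero.1 (pow_eq_zero_iff two_ne_zero |>.1 h2))
    rw [← this]; exact hzM
  have hR2 : Real.sqrt (N z) ^ 2 = N z := Real.sq_sqrt hNz.le
  obtain ⟨K₁, hK₁⟩ := hdisc.exists_bound_of_continuousOn (hβ₁.mono fun z hz => hsub z hz)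
  obtain ⟨K₂, hK₂⟩ := hdisc.exists_bound_of_continuousOn (hβ₂.mono fun z hz => hsub z hz)
  have hin : ∀ q : ℝ × ℝ, (q.1 - c.1) ^ 2 + (q.2 - c.2) ^ 2 ≤ Real.sqrt (N z) ^ 2 →
      (q.1 - c.1) ^ 2 + (q.2 - c.2) ^ 2 ≤ (ε / 3) ^ 2 := fun q hq => by linarith
  have hhopf := hopf_disc hQ (a := c.1) (b := c.2) (K := max K₁ K₂) (M := M) (p := z)
    (Real.sqrt_pos.2 hNz)
    (fun q hq => (hK₁ q (hin q hq.le)).trans (le_max_left _ _))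
    (fun q hq => (hK₂ q (hin q hq.le)).trans (le_max_right _ _))
    (fun q hq => heq q (hsub q (hin q hq.le)))
    (fun q hq => by
      refine lt_of_le_of_ne (hle q (hsub q (hin q hq.le))) fun h0 => ?_
      have : N z ≤ N q := hmin ⟨hin q hq.le, h0⟩
      rw [hR2] at hq
      exact absurd hq (not_lt.2 this))
    (fun q hq => hle q (hsub q (hin q hq))) hR2.symm hzM
  have hloc : IsLocalMax Q z := by
    filter_upwards [hΩ.mem_nhds (hsub z hzN')] with q hq
    have h1 := hle q hq
    have h2 : Q z = M := hzM
    rwa [h2]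
  have h0 := hloc.fderiv_eq_zero
  simp [pdX, pdY, h0] at hhopf

theorem hasFDerivAt_div {f k : ℝ × ℝ → ℝ} {f' k' : ℝ × ℝ →L[ℝ] ℝ} {p : ℝ × ℝ}
    (hf : HasFDerivAt f f' p) (hk : HasFDerivAt k k' p) (h0 : k p ≠ 0) :
    HasFDerivAt (fun p => f p / k p) ((k p ^ 2)⁻¹ • (k p • f' - f p • k')) p := by
  have : HasFDerivAt (fun p => f p * (k p)⁻¹) _ p :=
    hf.mul ((hasDerivAt_inv h0).comp_hasFDerivAt p hk)
  simp only [div_eq_mul_inv]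
  refine this.congr_fderiv (ContinuousLinearMap.ext fun w => ?_)
  simp only [add_apply, smul_apply, sub_apply, smul_eq_mul]
  field_simp
  ring

theorem hasFDerivAt_arctan_div {u v : ℝ × ℝ → ℝ} {u' v' : ℝ × ℝ →L[ℝ] ℝ} {p : ℝ × ℝ}
    (hu : HasFDerivAt u u' p) (hv : HasFDerivAt v v' p) (h0 : u p ≠ 0) :
    HasFDerivAt (fun p => Real.arctan (v p / u p))
      ((u p ^ 2 + v p ^ 2)⁻¹ • (u p • v' - v p • u')) p := by
  have hq : u p ^ 2 + v p ^ 2 ≠ 0 := by positivity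
  refine (hasFDerivAt_div hv hu h0).arctan.congr_fderiv (ContinuousLinearMap.ext fun w => ?_)
  simp only [smul_apply, sub_apply, smul_eq_mul]
  field_simp

/-- Away from stagnation points, the dynamic pressure
`Q = P + g y` satisfies `∇·(∇Q / |w|²) = 0`, since `∇Q / |w|²` is the rotated gradient of the
angle of the velocity `w = (u, v)`. -/
theorem laplacian_eq_of_euler {u v Q : ℝ × ℝ → ℝ} (hu : ContDiff ℝ 1 u) (hv : ContDiff ℝ 1 v)
    (hQ : ContDiff ℝ 2 Q) {Ω : Set (ℝ × ℝ)} (hΩ : IsOpen Ω)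
    (hx : ∀ p ∈ Ω, u p * pdX u p + v p * pdY u p = -pdX Q p)
    (hy : ∀ p ∈ Ω, u p * pdX v p + v p * pdY v p = -pdY Q p)
    (hdiv : ∀ p ∈ Ω, pdX u p + pdY v p = 0) {z : ℝ × ℝ} (hz : z ∈ Ω)
    (hq : u z ^ 2 + v z ^ 2 ≠ 0) :
    pdX (pdX Q) z + pdY (pdY Q) z =
      2 * (u z * pdX u z + v z * pdX v z) / (u z ^ 2 + v z ^ 2) * pdX Q z +
      2 * (u z * pdY u z + v z * pdY v z) / (u z ^ 2 + v z ^ 2) * pdY Q z := by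
  have hud : Differentiable ℝ u := hu.differentiable (by norm_num)
  have hvd : Differentiable ℝ v := hv.differentiable (by norm_num)
  have hQx : Differentiable ℝ (pdX Q) :=
    (hQ.pdX (m := 1) (by norm_num)).differentiable (by norm_num)
  have hQy : Differentiable ℝ (pdY Q) :=
    (hQ.pdY (m := 1) (by norm_num)).differentiable (by norm_num)
  set θ' : ℝ × ℝ → ℝ × ℝ →L[ℝ] ℝ := fun p =>
    (u p ^ 2 + v p ^ 2)⁻¹ • (u p • fderiv ℝ v p - v p • fderiv ℝ u p) with hθ'
  obtain ⟨θ, hθ⟩ : ∃ θ : ℝ × ℝ → ℝ, ∀ᶠ p in nhds z, HasFDerivAt θ (θ' p) p := by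
    by_cases h0 : u z = 0
    · have h1 : v z ≠ 0 := fun h => hq (by simp [h0, h])
      refine ⟨fun p => -Real.arctan (u p / v p), ?_⟩
      filter_upwards [hv.continuous.continuousAt.eventually_ne h1] with p hp
      refine (hasFDerivAt_arctan_div (hvd p).hasFDerivAt (hud p).hasFDerivAt hp).neg.congr_fderiv ?_
      rw [hθ', ← smul_neg, neg_sub, add_comm (v p ^ 2)]
    · refine ⟨fun p => Real.arctan (v p / u p), ?_⟩
      filter_upwards [hu.continuous.continuousAt.eventually_ne h0] with p hp
      exact hasFDerivAt_arctan_div (hud p).hasFDerivAt (hvd p).hasFDerivAt hp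
  set f₁ : ℝ × ℝ → ℝ := fun p => -pdY Q p / (u p ^ 2 + v p ^ 2)
  set f₂ : ℝ × ℝ → ℝ := fun p => pdX Q p / (u p ^ 2 + v p ^ 2)
  have hθ₂ : ∀ᶠ p in nhds z, HasFDerivAt θ
      (f₁ p • ContinuousLinearMap.fst ℝ ℝ ℝ + f₂ p • ContinuousLinearMap.snd ℝ ℝ ℝ) p := by
    filter_upwards [hθ, hΩ.mem_nhds hz] with p hp hpΩ
    refine hp.congr_fderiv (ContinuousLinearMap.ext fun w => ?_)
    have e1 := hx p hpΩ
    have e2 := hy p hpΩ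
    have e3 : pdX u p = -pdY v p := by linarith [hdiv p hpΩ]
    have e4 : pdX Q p = -(u p * -pdY v p + v p * pdY u p) := by rw [← e3]; linarith
    simp only [hθ', f₁, f₂, add_apply, smul_apply, sub_apply, ContinuousLinearMap.coe_fst', ContinuousLinearMap.coe_snd',
      smul_eq_mul, fderiv_apply_eq_pd, ← e2, e4, e3]
    ring
  have hq2 : HasFDerivAt (fun p => u p ^ 2 + v p ^ 2)
      ((2 * u z) • fderiv ℝ u z + (2 * v z) • fderiv ℝ v z) z := by
    have : HasFDerivAt (fun p => u p ^ 2 + v p ^ 2) _ z :=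
      ((hud z).hasFDerivAt.pow 2).add ((hvd z).hasFDerivAt.pow 2)
    simpa using this
  have hf₁ : HasFDerivAt f₁ _ z := hasFDerivAt_div (hQy z).hasFDerivAt.neg hq2 hq
  have hf₂ : HasFDerivAt f₂ _ z := hasFDerivAt_div (hQx z).hasFDerivAt hq2 hq
  have hsymm := second_derivative_symmetric_of_eventually hθ₂
    ((hf₁.smul_const (ContinuousLinearMap.fst ℝ ℝ ℝ)).add
      (hf₂.smul_const (ContinuousLinearMap.snd ℝ ℝ ℝ))) (1, 0) (0, 1)
  simp only [add_apply, ContinuousLinearMap.smulRight_apply, smul_apply, sub_apply, neg_apply,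
    fderiv_apply_eq_pd, ContinuousLinearMap.coe_fst', ContinuousLinearMap.coe_snd',
    smul_eq_mul, mul_zero, mul_one, zero_mul, one_mul, zero_add, add_zero] at hsymm
  field_simp at hsymm ⊢
  linarith

namespace GenPeriodicFlow

variable {g Patm L d : ℝ} (F : GenPeriodicFlow g Patm L d)

theorem X_add_int_mul (s : ℝ) (n : ℤ) : F.X (s + n * F.T) = F.X s + n * (2 * L) := by
  induction n using Int.induction_on with
  | zero => simp
  | succ n ih =>
    have := F.X_per (s + n * F.T)
    push_cast at ih ⊢
    rw [add_one_mul, ← add_assoc, this, ih]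
    ring
  | pred n ih =>
    have := F.X_per (s + (-n - 1) * F.T)
    push_cast at ih ⊢
    rw [show s + (-n - 1) * F.T + F.T = s + -n * F.T by ring, ih] at this
    linarith

theorem Y_periodic : Function.Periodic F.Y F.T := F.Y_per

theorem Y_add_int_mul (s : ℝ) (n : ℤ) : F.Y (s + n * F.T) = F.Y s := F.Y_periodic.int_mul n s

theorem exists_min_max_Y : ∃ s₀ s₁, ∀ s, F.Y s₀ ≤ F.Y s ∧ F.Y s ≤ F.Y s₁ := by
  have hne : (Icc (0 : ℝ) F.T).Nonempty := nonempty_Icc.2 F.T_pos.le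
  obtain ⟨s₀, -, h₀⟩ := isCompact_Icc.exists_isMinOn hne F.Y_smooth.continuous.continuousOn
  obtain ⟨s₁, -, h₁⟩ := isCompact_Icc.exists_isMaxOn hne F.Y_smooth.continuous.continuousOn
  refine ⟨s₀, s₁, fun s => ?_⟩
  obtain ⟨t, ht, hst⟩ := F.Y_periodic.exists_mem_Ico₀ F.T_pos s
  rw [hst]
  exact ⟨h₀ (Ico_subset_Icc_self ht), h₁ (Ico_subset_Icc_self ht)⟩

theorem Ω_translate {p : ℝ × ℝ} (hp : p ∈ F.Ω) (n : ℤ) : (p.1 + n * (2 * L), p.2) ∈ F.Ω := by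
  induction n using Int.induction_on with
  | zero => simpa using hp
  | succ n ih =>
    have := (F.Ω_per _).1 ih
    convert this using 2
    push_cast
    ring
  | pred n ih =>
    apply (F.Ω_per _).2
    convert ih using 2
    push_cast
    ring

theorem closure_translate {p : ℝ × ℝ} (hp : p ∈ closure F.Ω) (n : ℤ) :
    (p.1 + n * (2 * L), p.2) ∈ closure F.Ω :=
  map_mem_closure (f := fun p : ℝ × ℝ => (p.1 + n * (2 * L), p.2)) (by fun_prop) hp
    fun _ hq => F.Ω_translate hq n

theorem surf_mem_frontier (s : ℝ) : (F.X s, F.Y s) ∈ frontier F.Ω := by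
  rw [F.Ω_frontier]; exact Or.inl ⟨s, rfl⟩

theorem bed_mem_frontier (x : ℝ) : (x, -d) ∈ frontier F.Ω := by
  rw [F.Ω_frontier]; exact Or.inr rfl

theorem notMem_frontier {p : ℝ × ℝ} (hp : p ∈ F.Ω) : p ∉ frontier F.Ω :=
  disjoint_right.1 (disjoint_frontier_iff_isOpen.2 F.Ω_open) hp

theorem mem_cases {p : ℝ × ℝ} (hp : p ∈ closure F.Ω) :
    p ∈ F.Ω ∨ (∃ s, p = (F.X s, F.Y s)) ∨ p.2 = -d := by
  rw [closure_eq_self_union_frontier, F.Ω_frontier] at hp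
  rcases hp with h | ⟨s, hs⟩ | h
  · exact Or.inl h
  · exact Or.inr (Or.inl ⟨s, hs.symm⟩)
  · exact Or.inr (Or.inr h)

/-- A preconnected set which meets the fluid domain and avoids its frontier lies inside it. -/
theorem subset_Ω {U : Set (ℝ × ℝ)} (hU : IsPreconnected U) (hne : (U ∩ F.Ω).Nonempty)
    (hd : ∀ p ∈ U, p ∉ frontier F.Ω) : U ⊆ F.Ω := by
  apply hU.subset_of_closure_inter_subset F.Ω_open hne
  rintro p ⟨hp, hpU⟩
  rw [closure_eq_self_union_frontier] at hp
  exact hp.resolve_right (hd p hpU)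

/-- The fluid domain lies above the bed. -/
theorem bed_lt {p : ℝ × ℝ} (hp : p ∈ F.Ω) : -d < p.2 := by
  by_contra! h
  have hlt : p.2 < -d := lt_of_le_of_ne h fun h0 => F.notMem_frontier hp (by
    rw [F.Ω_frontier]; exact Or.inr h0)
  have hsub : F.Ω ⊆ {q : ℝ × ℝ | q.2 < -d} := by
    apply F.Ω_conn.isPreconnected.subset_of_closure_inter_subset
      (isOpen_lt continuous_snd continuous_const) ⟨p, hp, hlt⟩
    rintro q ⟨hq, hqΩ⟩
    have hq' : q.2 ≤ -d := closure_lt_subset_le continuous_snd continuous_const hq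
    exact lt_of_le_of_ne hq' fun h0 => F.notMem_frontier hqΩ (by
      rw [F.Ω_frontier]; exact Or.inr h0)
  have hcl : closure F.Ω ⊆ {q : ℝ × ℝ | q.2 ≤ -d} :=
    (closure_mono hsub).trans (closure_lt_subset_le continuous_snd continuous_const)
  exact absurd (hcl (frontier_subset_closure (F.surf_mem_frontier 0))) (not_le.2 (F.S_above_bed 0))

/-- The strip between the bed and the lowest point of the surface is filled with fluid. -/
theorem strip_subset {c : ℝ} (hc : -d < c) (hcY : ∀ s, c ≤ F.Y s) :
    {p : ℝ × ℝ | -d < p.2 ∧ p.2 < c} ⊆ F.Ω := by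
  have hset : {p : ℝ × ℝ | -d < p.2 ∧ p.2 < c} = univ ×ˢ Ioo (-d) c := by
    ext p; simp
  apply F.subset_Ω
  · rw [hset]
    exact (convex_univ.prod (convex_Ioo _ _)).isPreconnected
  · have hmem := frontier_subset_closure (F.bed_mem_frontier 0)
    obtain ⟨q, hq1, hq2⟩ := mem_closure_iff.1 hmem {p : ℝ × ℝ | p.2 < c}
      (isOpen_lt continuous_snd continuous_const) hc
    exact ⟨q, ⟨F.bed_lt hq2, hq1⟩, hq2⟩
  · rintro p ⟨h1, h2⟩ hp
    rw [F.Ω_frontier] at hp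
    rcases hp with ⟨s, rfl⟩ | h
    · exact absurd h2 (not_lt.2 (hcY s))
    · exact h1.ne' h

/-- The fluid domain does not reach above the surface: the surface, viewed in the `2L`-periodic
cylinder, winds around points above it but not around points below it. -/
theorem le_of_mem_Ω (hL : 0 < L) {C : ℝ} (hC : ∀ s, F.Y s ≤ C) {p : ℝ × ℝ} (hp : p ∈ F.Ω) :
    p.2 ≤ C := by
  by_contra! hpC
  set κ : ℂ := Complex.I * (Real.pi / L : ℝ) with hκ
  set e : ℝ × ℝ → ℂ := fun q => Complex.exp (κ * (q.1 + q.2 * Complex.I)) with he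
  have hec : Continuous e := by fun_prop
  have hπL : 0 < Real.pi / L := div_pos Real.pi_pos hL
  have hnorm : ∀ q, ‖e q‖ = Real.exp (-(Real.pi / L * q.2)) := by
    intro q
    simp [he, hκ, Complex.norm_exp]
  set k' : ℝ → ℂ := fun s => κ * (deriv F.X s + deriv F.Y s * Complex.I) with hk'
  set ζ : ℝ → ℂ := fun s => e (F.X s, F.Y s) with hζ
  have hXd : Differentiable ℝ F.X := F.X_smooth.differentiable (by norm_num)
  have hYd : Differentiable ℝ F.Y := F.Y_smooth.differentiable (by norm_num)
  have hk : ∀ s, HasDerivAt (fun s => κ * ((F.X s : ℂ) + F.Y s * Complex.I)) (k' s) s := fun s =>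
    ((hXd s).hasDerivAt.ofReal_comp.add
      ((hYd s).hasDerivAt.ofReal_comp.mul_const _)).const_mul κ
  have hζd : ∀ s, HasDerivAt ζ (ζ s * k' s) s := fun s => (hk s).cexp
  have hk'c : Continuous k' := by
    have h1 := F.X_smooth.continuous_deriv (by norm_num)
    have h2 := F.Y_smooth.continuous_deriv (by norm_num)
    fun_prop
  have hζc : Continuous ζ := continuous_iff_continuousAt.2 fun s => (hζd s).continuousAt
  have hζ'c : Continuous fun s => ζ s * k' s := hζc.mul hk'c
  have hκL : κ * (2 * L) = 2 * Real.pi * Complex.I := by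
    have : (L : ℂ) ≠ 0 := by exact_mod_cast hL.ne'
    rw [hκ]; push_cast; field_simp
  have hX0 : F.X F.T = F.X 0 + 2 * L := by simpa using F.X_per 0
  have hY0 : F.Y F.T = F.Y 0 := by simpa using F.Y_per 0
  have hclosed : ζ 0 = ζ F.T := by
    simp only [hζ, he, hX0, hY0]
    push_cast
    rw [show κ * ((F.X 0 : ℂ) + 2 * L + F.Y 0 * Complex.I)
      = κ * (F.X 0 + F.Y 0 * Complex.I) + κ * (2 * L) by ring, hκL, Complex.exp_add,
      Complex.exp_two_pi_mul_I, mul_one]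
  have hne : ∀ q ∈ F.Ω, ∀ s ∈ Icc 0 F.T, ζ s ≠ e q := by
    intro q hq s _ h
    obtain ⟨n, hn⟩ := Complex.exp_eq_exp_iff_exists_int.1 h
    rw [← hκL, show κ * ((q.1 : ℂ) + q.2 * Complex.I) + n * (κ * (2 * L))
      = κ * (q.1 + n * (2 * L) + q.2 * Complex.I) by ring] at hn
    have hκ0 : κ ≠ 0 := by
      rw [hκ]; exact mul_ne_zero Complex.I_ne_zero (by exact_mod_cast hπL.ne')
    have hn' := mul_left_cancel₀ hκ0 hn
    have hre := congrArg Complex.re hn'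
    have him := congrArg Complex.im hn'
    simp at hre him
    have h1 := F.Ω_translate hq n
    rw [← hre, ← him] at h1
    exact F.notMem_frontier h1 (F.surf_mem_frontier s)
  obtain ⟨s₀, _, hs₀⟩ := F.exists_min_max_Y
  obtain ⟨q, hq1, hq2⟩ : ∃ q : ℝ × ℝ, q ∈ F.Ω ∧ q.2 < F.Y s₀ := by
    have hb := F.S_above_bed s₀
    exact ⟨(0, (-d + F.Y s₀) / 2), F.strip_subset hb (fun s => (hs₀ s).1)
      ⟨by simp only; linarith, by simp only; linarith⟩, by simp only; linarith⟩
  have hconst := integral_div_sub_eq_of_isPreconnected F.T_pos.le hζd hζ'c hclosed F.Ω_open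
    F.Ω_conn.isPreconnected hec hne hp hq1
  rw [integral_div_sub_eq_zero F.T_pos.le hζd hζ'c hclosed (w := e q) (fun s _ => by
      simp only [hζ, hnorm, Real.exp_lt_exp, neg_lt_neg_iff]
      exact mul_lt_mul_of_pos_left (hq2.trans_le (hs₀ s).1) hπL),
    integral_div_sub_eq F.T_pos.le hζd hζ'c hclosed (w := 0) (w' := e p) (fun s _ => by
      simp only [hζ, hnorm, sub_zero, Real.exp_lt_exp, neg_lt_neg_iff]
      exact mul_lt_mul_of_pos_left ((hC s).trans_lt hpC) hπL)] at hconst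
  have hint : ∫ s in (0 : ℝ)..F.T, ζ s * k' s / (ζ s - 0) = ∫ s in (0 : ℝ)..F.T, k' s := by
    congr 1
    ext s
    rw [sub_zero, mul_div_cancel_left₀ _ (Complex.exp_ne_zero _)]
  rw [hint, intervalIntegral.integral_eq_sub_of_hasDerivAt (fun s _ => hk s)
    (hk'c.intervalIntegrable _ _), hX0, hY0] at hconst
  push_cast at hconst
  rw [show κ * ((F.X 0 : ℂ) + 2 * L + F.Y 0 * Complex.I) - κ * (F.X 0 + F.Y 0 * Complex.I)
    = κ * (2 * L) by ring, hκL] at hconst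
  exact Complex.two_pi_I_ne_zero hconst

/-- Maximum principle on the fluid domain with a homogeneous Neumann condition on the bed: the
maximum is attained on the surface only. -/
theorem exists_max_on_surf (hL : 0 < L) {Q β₁ β₂ : ℝ × ℝ → ℝ} (hQ : ContDiff ℝ 2 Q)
    (hper : ∀ x y, Q (x + 2 * L, y) = Q (x, y))
    (hβ₁ : ContinuousOn β₁ (closure F.Ω)) (hβ₂ : ContinuousOn β₂ (closure F.Ω))
    (heq : ∀ z ∈ F.Ω, pdX (pdX Q) z + pdY (pdY Q) z = β₁ z * pdX Q z + β₂ z * pdY Q z)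
    (hbed : ∀ x, pdY Q (x, -d) = 0)
    (hnc : ∃ s s', Q (F.X s, F.Y s) ≠ Q (F.X s', F.Y s')) :
    ∃ s₀, ∀ p ∈ closure F.Ω, Q p ≤ Q (F.X s₀, F.Y s₀) ∧
      (Q p = Q (F.X s₀, F.Y s₀) → ∃ s, p = (F.X s, F.Y s)) := by
  have hQc := hQ.continuous
  obtain ⟨sm, sM, hY⟩ := F.exists_min_max_Y
  have hQper : ∀ (y : ℝ), Function.Periodic (fun x => Q (x, y)) (2 * L) := fun y x => hper x y
  have hbox : closure F.Ω ⊆ {p : ℝ × ℝ | -d ≤ p.2} ∩ {p : ℝ × ℝ | p.2 ≤ F.Y sM} :=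
    closure_minimal (fun z hz => ⟨(F.bed_lt hz).le, F.le_of_mem_Ω hL (fun s => (hY s).2) hz⟩)
      ((isClosed_le continuous_const continuous_snd).inter
        (isClosed_le continuous_snd continuous_const))
  have hK : IsCompact (Icc 0 (2 * L) ×ˢ Icc (-d) (F.Y sM) ∩ closure F.Ω) :=
    (isCompact_Icc.prod isCompact_Icc).inter_right isClosed_closure
  have htrans : ∀ p ∈ closure F.Ω, ∃ q ∈ Icc 0 (2 * L) ×ˢ Icc (-d) (F.Y sM) ∩ closure F.Ω,
      Q p = Q q := by
    intro p hp
    obtain ⟨n, hn, -⟩ := existsUnique_add_zsmul_mem_Ico (show 0 < 2 * L by positivity) p.1 0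
    rw [zsmul_eq_mul, zero_add] at hn
    exact ⟨(p.1 + n * (2 * L), p.2), ⟨⟨Ico_subset_Icc_self hn, (hbox hp).1, (hbox hp).2⟩,
      F.closure_translate hp n⟩, ((hQper p.2).int_mul n p.1).symm⟩
  have hbedcl : ∀ x, (x, -d) ∈ closure F.Ω := fun x =>
    frontier_subset_closure (F.bed_mem_frontier x)
  have hsurfcl : ∀ s, (F.X s, F.Y s) ∈ closure F.Ω := fun s =>
    frontier_subset_closure (F.surf_mem_frontier s)
  obtain ⟨q₀, hq₀, -⟩ := htrans _ (hbedcl 0)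
  obtain ⟨z₀, ⟨-, hz₀⟩, hmax⟩ := hK.exists_isMaxOn ⟨q₀, hq₀⟩ hQc.continuousOn
  have hle : ∀ p ∈ closure F.Ω, Q p ≤ Q z₀ := by
    intro p hp
    obtain ⟨q, hq, hpq⟩ := htrans p hp
    rw [hpq]
    exact hmax hq
  have hint : ∀ p ∈ F.Ω, Q p < Q z₀ := by
    intro p hp
    refine lt_of_le_of_ne (hle p (subset_closure hp)) fun hpM => ?_
    have hall := eq_max_of_isPreconnected hQ F.Ω_open F.Ω_conn.isPreconnected
      (hβ₁.mono subset_closure) (hβ₂.mono subset_closure) heq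
      (fun z hz => hle z (subset_closure hz)) hp hpM
    have hcl : closure F.Ω ⊆ {z | Q z = Q z₀} :=
      closure_minimal hall (isClosed_eq hQc continuous_const)
    obtain ⟨s, s', hss⟩ := hnc
    exact hss ((hcl (hsurfcl s)).trans (hcl (hsurfcl s')).symm)
  have hbedlt : ∀ x, Q (x, -d) ≠ Q z₀ := by
    intro x hx
    set R := (F.Y sm + d) / 3 with hRdef
    have hR : 0 < R := by have := F.S_above_bed sm; rw [hRdef]; linarith
    have hmem : ∀ z : ℝ × ℝ, (z.1 - x) ^ 2 + (z.2 - (-d + R)) ^ 2 < R ^ 2 → z ∈ F.Ω := by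
      intro z hz
      have := abs_lt.1 (abs_lt_of_sq_lt_sq (a := z.2 - (-d + R)) (b := R)
        (by nlinarith [sq_nonneg (z.1 - x)]) hR.le)
      exact F.strip_subset (F.S_above_bed sm) (fun s => (hY s).1)
        ⟨by linarith [this.1], by linarith [this.2]⟩
    have hmem' : ∀ z : ℝ × ℝ, (z.1 - x) ^ 2 + (z.2 - (-d + R)) ^ 2 ≤ R ^ 2 →
        z ∈ closure F.Ω := by
      intro z hz
      have := abs_le.1 (abs_le_of_sq_le_sq (a := z.2 - (-d + R)) (b := R)
        (by nlinarith [sq_nonneg (z.1 - x)]) hR.le)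
      rcases (show -d ≤ z.2 by linarith [this.1]).eq_or_lt with h | h
      · have : z = (z.1, -d) := Prod.ext rfl h.symm
        rw [this]; exact hbedcl _
      · exact subset_closure (F.strip_subset (F.S_above_bed sm) (fun s => (hY s).1)
          ⟨h, by linarith [this.2]⟩)
    have hdisc := isCompact_disc x (-d + R) hR.le
    obtain ⟨K₁, hK₁⟩ := hdisc.exists_bound_of_continuousOn (hβ₁.mono hmem')
    obtain ⟨K₂, hK₂⟩ := hdisc.exists_bound_of_continuousOn (hβ₂.mono hmem')
    have := hopf_disc hQ (a := x) (b := -d + R) (K := max K₁ K₂) (M := Q z₀) (p := (x, -d)) hR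
      (fun q hq => (hK₁ q hq.le).trans (le_max_left _ _))
      (fun q hq => (hK₂ q hq.le).trans (le_max_right _ _))
      (fun q hq => heq q (hmem q hq)) (fun q hq => hint q (hmem q hq))
      (fun q hq => hle q (hmem' q hq)) (by simp only; ring) hx
    rw [hbed] at this
    simp at this
  have hsurf : ∀ p ∈ closure F.Ω, Q p = Q z₀ → ∃ s, p = (F.X s, F.Y s) := by
    intro p hp hpM
    rcases F.mem_cases hp with h | h | h
    · exact absurd hpM (hint p h).ne
    · exact h
    · have : p = (p.1, -d) := Prod.ext rfl h
      exact absurd (this ▸ hpM) (hbedlt p.1)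
  obtain ⟨s₀, hs₀⟩ := hsurf z₀ hz₀ rfl
  exact ⟨s₀, fun p hp => ⟨hs₀ ▸ hle p hp, fun h => hsurf p hp (h.trans (hs₀ ▸ rfl))⟩⟩

theorem pdX_v_bed (x : ℝ) : pdX F.v (x, -d) = 0 := by
  have h1 := hasDerivAt_pdX (F.v_smooth.differentiable (by norm_num)) x (-d)
  have h2 : (fun t => F.v (t, -d)) = fun _ => 0 := funext F.bed_kinematic
  rw [h2] at h1
  exact h1.unique (hasDerivAt_const x 0)

theorem pdY_P_bed (x : ℝ) : pdY F.P (x, -d) + g = 0 := by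
  have hu := F.u_smooth.continuous
  have hv := F.v_smooth.continuous
  have hvx := (F.v_smooth.pdX (m := 0) (by norm_num)).continuous
  have hvy := (F.v_smooth.pdY (m := 0) (by norm_num)).continuous
  have hPy := (F.P_smooth.pdY (m := 1) (by norm_num)).continuous
  have hcl : closure F.Ω ⊆
      {p | F.u p * pdX F.v p + F.v p * pdY F.v p = -(pdY F.P p) - g} :=
    closure_minimal F.euler_y (isClosed_eq (by fun_prop) (by fun_prop))
  have h : F.u (x, -d) * pdX F.v (x, -d) + F.v (x, -d) * pdY F.v (x, -d)
      = -(pdY F.P (x, -d)) - g := hcl (frontier_subset_closure (F.bed_mem_frontier x))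
  rw [F.pdX_v_bed, F.bed_kinematic] at h
  linarith

end GenPeriodicFlow

/-- **Pressure bounds.**  For a nontrivial flow with no stagnation points in the closure
of `Ω`, one has `g·minη ≤ P − Patm + g y ≤ g·maxη` on the closure of `Ω`, with equality
in the upper bound only at crests and in the lower bound only at troughs. -/
theorem pressure_bounds (g Patm L d : ℝ) (hg : 0 < g) (hL : 0 < L) (hd : 0 < d)
    (F : GenPeriodicFlow g Patm L d)
    (hnt : F.Nontrivial')
    (hstag : ∀ p ∈ closure F.Ω, F.u p ^ 2 + F.v p ^ 2 ≠ 0) :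
    ∀ p ∈ closure F.Ω,
      (g * F.minη ≤ F.P p - Patm + g * p.2 ∧ F.P p - Patm + g * p.2 ≤ g * F.maxη) ∧
      (F.P p - Patm + g * p.2 = g * F.maxη → ∃ s, p = (F.X s, F.Y s) ∧ F.Y s = F.maxη) ∧
      (F.P p - Patm + g * p.2 = g * F.minη → ∃ s, p = (F.X s, F.Y s) ∧ F.Y s = F.minη) := by
  have hpdX_neg : ∀ f : ℝ × ℝ → ℝ, pdX (fun p => -f p) = fun p => -pdX f p := fun f => by
    ext p; simp [pdX]
  have hpdY_neg : ∀ f : ℝ × ℝ → ℝ, pdY (fun p => -f p) = fun p => -pdY f p := fun f => by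
    ext p; simp [pdY]
  set Q : ℝ × ℝ → ℝ := fun p => F.P p - Patm + g * p.2 with hQdef
  have hP := F.P_smooth
  have hQ : ContDiff ℝ 2 Q := by fun_prop
  have hQd : ∀ p, HasFDerivAt Q (fderiv ℝ F.P p + g • ContinuousLinearMap.snd ℝ ℝ ℝ) p := fun p =>
    ((hP.differentiable (by norm_num) p).hasFDerivAt.sub_const Patm).add
      (hasFDerivAt_snd.const_mul g)
  have hQx : ∀ p, pdX Q p = pdX F.P p := fun p => by simp [pdX, (hQd p).fderiv]
  have hQy : ∀ p, pdY Q p = pdY F.P p + g := fun p => by simp [pdY, (hQd p).fderiv]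
  have hQS : ∀ s, Q (F.X s, F.Y s) = g * F.Y s := fun s => by
    simp [hQdef, F.surface_pressure s]
  have hu := F.u_smooth
  have hv := F.v_smooth
  have hux := (hu.pdX (m := 0) (by norm_num)).continuous
  have huy := (hu.pdY (m := 0) (by norm_num)).continuous
  have hvx := (hv.pdX (m := 0) (by norm_num)).continuous
  have hvy := (hv.pdY (m := 0) (by norm_num)).continuous
  have huc := hu.continuous
  have hvc := hv.continuous
  set β₁ : ℝ × ℝ → ℝ := fun z =>
    2 * (F.u z * pdX F.u z + F.v z * pdX F.v z) / (F.u z ^ 2 + F.v z ^ 2)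
  set β₂ : ℝ × ℝ → ℝ := fun z =>
    2 * (F.u z * pdY F.u z + F.v z * pdY F.v z) / (F.u z ^ 2 + F.v z ^ 2)
  have hβ₁ : ContinuousOn β₁ (closure F.Ω) :=
    ContinuousOn.div (by fun_prop) (by fun_prop) hstag
  have hβ₂ : ContinuousOn β₂ (closure F.Ω) :=
    ContinuousOn.div (by fun_prop) (by fun_prop) hstag
  have heq : ∀ z ∈ F.Ω, pdX (pdX Q) z + pdY (pdY Q) z = β₁ z * pdX Q z + β₂ z * pdY Q z :=
    fun z hz => laplacian_eq_of_euler hu hv hQ F.Ω_open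
      (fun p hp => by rw [hQx, F.euler_x p hp])
      (fun p hp => by rw [hQy, F.euler_y p hp]; ring) F.incompressible hz
      (hstag z (subset_closure hz))
  have hper : ∀ x y, Q (x + 2 * L, y) = Q (x, y) := fun x y => by
    simp only [hQdef, F.P_periodic]
  have hbed : ∀ x, pdY Q (x, -d) = 0 := fun x => by rw [hQy, F.pdY_P_bed]
  obtain ⟨t, t', htt⟩ := hnt
  have hnc : Q (F.X t, F.Y t) ≠ Q (F.X t', F.Y t') := by
    rw [hQS, hQS]; exact fun h => htt (mul_left_cancel₀ hg.ne' h)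
  obtain ⟨sM, hM⟩ := F.exists_max_on_surf hL hQ hper hβ₁ hβ₂ heq hbed ⟨t, t', hnc⟩
  obtain ⟨sm, hm⟩ := F.exists_max_on_surf hL hQ.neg (fun x y => by simp only [hper]) hβ₁ hβ₂
    (fun z hz => by simp only [hpdX_neg, hpdY_neg]; linarith [heq z hz])
    (fun x => by simp only [hpdY_neg, hbed, neg_zero]) ⟨t, t', fun h => hnc (neg_inj.1 h)⟩
  simp only [neg_le_neg_iff, neg_inj, hQS] at hM hm
  have hscl : ∀ s, (F.X s, F.Y s) ∈ closure F.Ω := fun s =>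
    frontier_subset_closure (F.surf_mem_frontier s)
  have hmaxη : F.maxη = F.Y sM := by
    refine IsGreatest.csSup_eq ⟨⟨sM, rfl⟩, ?_⟩
    rintro _ ⟨s, rfl⟩
    have := (hM _ (hscl s)).1
    rw [hQS] at this
    exact le_of_mul_le_mul_left this hg
  have hminη : F.minη = F.Y sm := by
    refine IsLeast.csInf_eq ⟨⟨sm, rfl⟩, ?_⟩
    rintro _ ⟨s, rfl⟩
    have := (hm _ (hscl s)).1
    rw [hQS] at this
    exact le_of_mul_le_mul_left this hg
  intro p hp
  rw [hmaxη, hminη]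
  refine ⟨⟨(hm p hp).1, (hM p hp).1⟩, fun h => ?_, fun h => ?_⟩
  · obtain ⟨s, rfl⟩ := (hM p hp).2 h
    exact ⟨s, rfl, mul_left_cancel₀ hg.ne' ((hQS s).symm.trans h)⟩
  · obtain ⟨s, rfl⟩ := (hm p hp).2 h
    exact ⟨s, rfl, mul_left_cancel₀ hg.ne' ((hQS s).symm.trans h)⟩
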